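/- Let N ≥ 1 be an integer. For every measurable function f : ℝ → [0, ∞] and every measurable function Φ : ℂ^N → [0, ∞], one has ∫_{ℂ^{N+1}} f(‖z‖²) · Φ(z_1/z_{N+1}, …, z_N/z_{N+1}) dz = π ∫_{ℂ^N} Φ(w) ( ∫_0^∞ f( t (1 + ‖w‖²) ) t^N dt ) dw, where dz and dw denote Lebesgue measure on ℂ^{N+1} ≅ ℝ^{2(N+1)} and ℂ^N ≅ ℝ^{2N} respectively, ‖·‖ is the standard Hermitian norm, and the integrand on the left is defined for z_{N+1} ≠ 0 (a set of full measure). (This is the change of variables z_j = w_j z_{N+1}, z_{N+1} = √t e^{iθ} underlying Lemma 3.1.) -/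

import Mathlib

open MeasureTheory Complex

/-- Scaling by a nonzero complex number multiplies Lebesgue measure on `ℂ^ι` by
`‖ζ‖ ^ (2 * card ι)`. -/
theorem lintegral_eq_norm_pow_mul_lintegral_comp_smul {ι : Type*} [Fintype ι] {ζ : ℂ}
    (hζ : ζ ≠ 0) {g : (ι → ℂ) → ENNReal} (hg : Measurable g) :
    ∫⁻ v, g v =
      ENNReal.ofReal ((‖ζ‖ ^ 2) ^ Fintype.card ι) * ∫⁻ w, g (ζ • w) := by
  let L : (ι → ℂ) →ₗ[ℝ] (ι → ℂ) := (ζ • (LinearMap.id : (ι → ℂ) →ₗ[ℂ] (ι → ℂ))).restrictScalars ℝ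
  have hpos : 0 < (‖ζ‖ ^ 2) ^ Fintype.card ι := by positivity
  have hdet : LinearMap.det L = (‖ζ‖ ^ 2) ^ Fintype.card ι := by
    rw [LinearMap.det_restrictScalars, LinearMap.det_smul, LinearMap.det_id, mul_one,
      Module.finrank_fintype_fun_eq_card, map_pow, Algebra.norm_complex_apply,
      Complex.normSq_eq_norm_sq]
  have hmap := Measure.map_linearMap_addHaar_eq_smul_addHaar
    (volume : Measure (ι → ℂ)) (f := L) (by rw [hdet]; exact hpos.ne')
  have hcomp : ∫⁻ w, g (ζ • w) = ∫⁻ v, g v ∂(Measure.map L volume) :=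
    (lintegral_map hg (measurable_const_smul ζ)).symm
  rw [hcomp, hmap, lintegral_smul_measure, hdet, abs_of_pos (inv_pos.2 hpos), smul_eq_mul,
    ← mul_assoc, ← ENNReal.ofReal_mul hpos.le, mul_inv_cancel₀ hpos.ne', ENNReal.ofReal_one,
    one_mul]

/-- Integration over `ℂ` of a function of `‖ζ‖ ^ 2`. -/
theorem Complex.lintegral_comp_norm_sq {h : ℝ → ENNReal} (hh : Measurable h) :
    ∫⁻ ζ : ℂ, h (‖ζ‖ ^ 2) = ENNReal.ofReal Real.pi * ∫⁻ t in Set.Ioi (0 : ℝ), h t := by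
  have himage : (fun r : ℝ => r ^ 2) '' Set.Ioi 0 = Set.Ioi 0 := by
    ext t
    refine ⟨?_, fun ht => ⟨√t, Real.sqrt_pos.2 ht, Real.sq_sqrt (le_of_lt ht)⟩⟩
    rintro ⟨r, hr, rfl⟩
    exact pow_pos (Set.mem_Ioi.1 hr) 2
  have hsubst : ∫⁻ t in Set.Ioi (0 : ℝ), h t =
      2 * ∫⁻ r in Set.Ioi (0 : ℝ), ENNReal.ofReal r * h (r ^ 2) := by
    rw [← lintegral_const_mul _ (by fun_prop), ← himage,
      lintegral_image_eq_lintegral_abs_deriv_mul (f' := fun r => 2 * r) measurableSet_Ioi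
        (fun r _ => by simpa using (hasDerivAt_pow 2 r).hasDerivWithinAt)
        (fun a ha b hb hab => (pow_left_inj₀ (le_of_lt ha) (le_of_lt hb) two_ne_zero).1 hab),
      himage]
    refine setLIntegral_congr_fun measurableSet_Ioi fun r hr => ?_
    have hr : 0 < r := hr
    rw [abs_of_pos (by positivity), ENNReal.ofReal_mul zero_le_two, ENNReal.ofReal_ofNat, mul_assoc]
  rw [← Complex.lintegral_comp_polarCoord_symm]
  have hpolar (p : ℝ × ℝ) : ENNReal.ofReal p.1 • h (‖Complex.polarCoord.symm p‖ ^ 2) =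
      (fun r => ENNReal.ofReal r * h (r ^ 2)) p.1 * (fun _ : ℝ => (1 : ENNReal)) p.2 := by
    rw [Complex.norm_polarCoord_symm, sq_abs, smul_eq_mul, mul_one]
  simp_rw [hpolar]
  rw [polarCoord_target, Measure.volume_eq_prod, ← Measure.prod_restrict,
    lintegral_prod_mul (f := fun r => ENNReal.ofReal r * h (r ^ 2)) (g := fun _ => 1)
      (by fun_prop) (by fun_prop), hsubst, lintegral_one,
    Measure.restrict_apply_univ, Real.volume_Ioo, sub_neg_eq_add, ← two_mul,
    ENNReal.ofReal_mul zero_le_two, ENNReal.ofReal_ofNat]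
  ring

/-- The change of variables `z_j = w_j z_{N+1}`, `z_{N+1} = √t e^{iθ}` underlying Lemma 3.1:
for measurable `f : ℝ → [0,∞]` and `Φ : ℂ^N → [0,∞]`,
`∫_{ℂ^{N+1}} f(‖z‖²) Φ(z_1/z_{N+1},…,z_N/z_{N+1}) dz
  = π ∫_{ℂ^N} Φ(w) (∫_0^∞ f(t(1+‖w‖²)) t^N dt) dw`. -/
theorem change_of_variables_projective (N : ℕ) (hN : 1 ≤ N)
    (f : ℝ → ENNReal) (hf : Measurable f)
    (Φ : (Fin N → ℂ) → ENNReal) (hΦ : Measurable Φ) :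
    ∫⁻ z : Fin (N + 1) → ℂ,
        f (∑ i, ‖z i‖ ^ 2) * Φ (fun j : Fin N => z j.castSucc / z (Fin.last N))
      = ENNReal.ofReal Real.pi *
        ∫⁻ w : Fin N → ℂ,
          Φ w * ∫⁻ t in Set.Ioi (0 : ℝ),
            f (t * (1 + ∑ j, ‖w j‖ ^ 2)) * ENNReal.ofReal (t ^ N) := by
  let G : ℂ × (Fin N → ℂ) → ENNReal := fun p =>
    f (∑ j, ‖p.2 j‖ ^ 2 + ‖p.1‖ ^ 2) * Φ (fun j => p.2 j / p.1)
  have hG : Measurable G := by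
    refine (hf.comp (by fun_prop)).mul (hΦ.comp (measurable_pi_iff.2 fun j => ?_))
    exact ((measurable_pi_apply j).comp measurable_snd).div measurable_fst
  let H : ℂ → (Fin N → ℂ) → ENNReal := fun ζ w =>
    Φ w * (f (‖ζ‖ ^ 2 * (1 + ∑ j, ‖w j‖ ^ 2)) * ENNReal.ofReal ((‖ζ‖ ^ 2) ^ N))
  have hH : Measurable (Function.uncurry H) :=
    (hΦ.comp measurable_snd).mul ((hf.comp (by fun_prop)).mul (by fun_prop))
  have hsplit : ∫⁻ z : Fin (N + 1) → ℂ,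
      f (∑ i, ‖z i‖ ^ 2) * Φ (fun j : Fin N => z j.castSucc / z (Fin.last N)) =
      ∫⁻ p, G p := by
    rw [← (volume_preserving_piFinSuccAbove (fun _ : Fin (N + 1) => ℂ)
      (Fin.last N)).lintegral_comp hG]
    refine lintegral_congr fun z => ?_
    simp [G, MeasurableEquiv.piFinSuccAbove, Fin.insertNthEquiv, Fin.init,
      Fin.sum_univ_castSucc]
  have hinner {ζ : ℂ} (hζ : ζ ≠ 0) : ∫⁻ v, G (ζ, v) = ∫⁻ w, H ζ w := by
    rw [lintegral_eq_norm_pow_mul_lintegral_comp_smul hζ (by fun_prop), Fintype.card_fin,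
      ← lintegral_const_mul _ (by fun_prop)]
    refine lintegral_congr fun w => ?_
    have hsum : ∑ j, ‖ζ * w j‖ ^ 2 + ‖ζ‖ ^ 2 = ‖ζ‖ ^ 2 * (1 + ∑ j, ‖w j‖ ^ 2) := by
      simp_rw [norm_mul, mul_pow, ← Finset.mul_sum]
      ring
    simp only [G, H, Pi.smul_apply, smul_eq_mul, hsum, mul_div_cancel_left₀ _ hζ]
    ring
  have hne : ∀ᵐ ζ : ℂ, ζ ≠ 0 := Measure.ae_ne volume 0
  rw [hsplit, Measure.volume_eq_prod, lintegral_prod _ hG.aemeasurable,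
    lintegral_congr_ae (hne.mono fun ζ hζ => hinner hζ),
    lintegral_lintegral_swap hH.aemeasurable, ← lintegral_const_mul' _ _ ENNReal.ofReal_ne_top]
  refine lintegral_congr fun w => ?_
  have hw : Measurable fun t : ℝ =>
      f (t * (1 + ∑ j, ‖w j‖ ^ 2)) * ENNReal.ofReal (t ^ N) := by fun_prop
  simp only [H]
  rw [lintegral_const_mul _ (by fun_prop), Complex.lintegral_comp_norm_sq hw]
  ring
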